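/- Let l ≥ 1 and let a_1, …, a_l be positive integers; let 𝔞 denote the number of indices i with a_i = 1. For a tuple σ = (σ_1, …, σ_l) in S_{a_1} × ⋯ × S_{a_l}, set δ(σ) = 2^{c(σ_1)+⋯+c(σ_l)−1} if every orbit of every σ_i has even size, and δ(σ) = 0 otherwise. Then the sum over all such tuples σ of the quantity 2^{c(σ_1)+⋯+c(σ_l)−1} − 1 − (n_2(σ_1) + ⋯ + n_2(σ_l)) − binom(n_1(σ_1) + ⋯ + n_1(σ_l), 2) + δ(σ) equals a_1!⋯a_l! · ( P − 1 − (l − 𝔞) − binom(l,2) ), where P = ((a_1+1)⋯(a_l+1) + 1)/2 if every a_i is even, and P = (a_1+1)⋯(a_l+1)/2 otherwise. -/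

import Mathlib

open Equiv Finset

/-- The number of cycles (orbits) of a permutation, counting fixed points
as orbits of size one. -/
noncomputable def Equiv.Perm.numCycles {α : Type*} (σ : Equiv.Perm α) : ℕ :=
  Nat.card (Quotient (Equiv.Perm.SameCycle.setoid σ))

/-- The size of the orbit of `x` under the permutation `σ`. -/
noncomputable def Equiv.Perm.orbitSize {α : Type*} (σ : Equiv.Perm α) (x : α) : ℕ :=
  Nat.card {y // σ.SameCycle x y}

theorem Equiv.Perm.orbitSize_congr {α : Type*} (σ : Equiv.Perm α) {a b : α}
    (h : σ.SameCycle a b) : σ.orbitSize a = σ.orbitSize b :=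
  Nat.card_congr (Equiv.subtypeEquivRight fun y =>
    ⟨fun hy => h.symm.trans hy, fun hy => h.trans hy⟩)

/-- The number of orbits of the permutation `σ` of size exactly `j`. -/
noncomputable def Equiv.Perm.numOrbits {α : Type*} (σ : Equiv.Perm α) (j : ℕ) : ℕ :=
  Nat.card {ω : Quotient (Equiv.Perm.SameCycle.setoid σ) //
    Quotient.liftOn ω σ.orbitSize (fun _ _ h => σ.orbitSize_congr h) = j}

/-- Every orbit of the permutation `σ` has even size. -/
def Equiv.Perm.allOrbitsEven {α : Type*} (σ : Equiv.Perm α) : Prop :=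
  ∀ x : α, Even (σ.orbitSize x)

namespace Equiv.Perm
variable {α : Type*}

theorem apply_eq_of_sameCycle_of_comp_eq {β : Type*} {σ : Perm α} {f : α → β} (hf : f ∘ σ = f)
    {x y : α} (h : σ.SameCycle x y) : f x = f y := by
  obtain ⟨k, rfl⟩ := h
  have hσ : ∀ x, f (σ x) = f x := congrFun hf
  have hσ' : ∀ x, f (σ⁻¹ x) = f x := fun x => by simpa using (hσ (σ⁻¹ x)).symm
  induction k with
  | zero => rfl
  | succ k ih => rwa [add_comm, zpow_add, zpow_one, mul_apply, hσ]
  | pred k ih => rwa [sub_eq_neg_add, zpow_add, zpow_neg_one, mul_apply, hσ']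

/-- Colourings invariant under `σ` correspond to colourings of the orbits of `σ`. -/
def invariantColoringEquiv (σ : Perm α) (β : Type*) :
    {f : α → β // f ∘ σ = f} ≃ (Quotient (SameCycle.setoid σ) → β) where
  toFun f := Quotient.lift f.1 fun _ _ h => apply_eq_of_sameCycle_of_comp_eq f.2 h
  invFun g := ⟨fun x => g ⟦x⟧, funext fun x => congrArg g (Quotient.sound
    (sameCycle_apply_left.2 (SameCycle.refl σ x)))⟩
  left_inv _ := rfl
  right_inv _ := funext fun q => Quotient.inductionOn q fun _ => rfl

theorem card_invariantColoring [Finite α] (σ : Perm α) :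
    Nat.card {f : α → Bool // f ∘ σ = f} = 2 ^ σ.numCycles := by
  rw [Nat.card_congr (invariantColoringEquiv σ Bool), Nat.card_fun]
  simp [numCycles]

theorem orbitSize_eq_minimalPeriod [Finite α] (σ : Perm α) (x : α) :
    σ.orbitSize x = Function.minimalPeriod σ x := by
  have := Fintype.ofFinite (MulAction.orbit (Subgroup.zpowers σ) x)
  refine .trans (Nat.card_congr (Equiv.subtypeEquivRight fun y => ?_))
    (Nat.card_eq_fintype_card.trans (MulAction.minimalPeriod_eq_card (a := σ) (b := x)).symm)
  constructor
  · rintro ⟨k, rfl⟩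
    exact ⟨⟨σ ^ k, k, rfl⟩, rfl⟩
  · rintro ⟨⟨_, k, rfl⟩, rfl⟩
    exact ⟨k, rfl⟩

theorem orbitSize_dvd_iff [Finite α] (σ : Perm α) (x : α) (k : ℤ) :
    (σ.orbitSize x : ℤ) ∣ k ↔ (σ ^ k) x = x := by
  rw [orbitSize_eq_minimalPeriod]
  exact (MulAction.zpow_smul_eq_iff_minimalPeriod_dvd (a := σ) (b := x)).symm

theorem not_apply_zpow {σ : Perm α} {g : α → Bool} (hg : ∀ x, g (σ x) = !g x) (k : ℤ) (x : α) :
    g ((σ ^ k) x) = (g x ^^ decide (Odd k)) := by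
  have hg' : ∀ x, g (σ⁻¹ x) = !g x := fun x => by simpa using (congrArg not (hg (σ⁻¹ x))).symm
  induction k with
  | zero => simp
  | succ k ih =>
    rw [add_comm, zpow_add, zpow_one, mul_apply, hg, ih, ← Bool.xor_not, ← decide_not]
    congr 2
    grind
  | pred k ih =>
    rw [sub_eq_neg_add, zpow_add, zpow_neg_one, mul_apply, hg', ih, ← Bool.xor_not, ← decide_not]
    congr 2
    grind

theorem exists_alternatingColoring_iff [Finite α] (σ : Perm α) :
    (∃ g : α → Bool, ∀ x, g (σ x) = !g x) ↔ σ.allOrbitsEven := by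
  constructor
  · rintro ⟨g, hg⟩ x
    have h := not_apply_zpow hg (σ.orbitSize x) x
    rw [(orbitSize_dvd_iff σ x _).1 dvd_rfl] at h
    by_contra hodd
    simp_all
  · intro h
    have hrep : ∀ x, ∃ k : ℤ, (σ ^ k) (Quotient.out (s := SameCycle.setoid σ) ⟦x⟧) = x :=
      fun x => Quotient.mk_out (s := SameCycle.setoid σ) x
    choose k hk using hrep
    refine ⟨fun x => decide (Odd (k x)), fun x => ?_⟩
    have hx : (⟦σ x⟧ : Quotient (SameCycle.setoid σ)) = ⟦x⟧ :=
      Quotient.sound (sameCycle_apply_left.2 (SameCycle.refl σ x))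
    have h1 := hk (σ x)
    rw [hx] at h1
    set r := Quotient.out (s := SameCycle.setoid σ) ⟦x⟧ with hr
    have h2 : (σ ^ (k (σ x) - (1 + k x))) r = r := by
      rw [sub_eq_neg_add, zpow_add, mul_apply, h1, zpow_neg, inv_eq_iff_eq, zpow_add, mul_apply, hk,
        zpow_one]
    have h3 := (Int.natCast_dvd_natCast.2 (h r).two_dvd).trans ((orbitSize_dvd_iff σ r _).2 h2)
    have : Odd (k (σ x)) ↔ ¬ Odd (k x) := by
      grind
    by_cases hk : Odd (k x) <;> simp [this, hk]

/-- Translating by an alternating colouring identifies alternating and invariant colourings. -/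
def alternatingColoringEquiv (σ : Perm α) {g : α → Bool} (hg : ∀ x, g (σ x) = !g x) :
    {f : α → Bool // ∀ x, f (σ x) = !f x} ≃ {f : α → Bool // f ∘ σ = f} where
  toFun f := ⟨fun x => f.1 x ^^ g x, funext fun x => by simp [f.2 x, hg x]⟩
  invFun f := ⟨fun x => f.1 x ^^ g x, fun x => by
    simp [show f.1 (σ x) = f.1 x from congrFun f.2 x, hg x]⟩
  left_inv f := by ext; simp
  right_inv f := by ext; simp

open scoped Classical in
theorem card_alternatingColoring [Finite α] (σ : Perm α) :
    Nat.card {f : α → Bool // ∀ x, f (σ x) = !f x} =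
      if σ.allOrbitsEven then 2 ^ σ.numCycles else 0 := by
  split_ifs with h
  · obtain ⟨g, hg⟩ := (exists_alternatingColoring_iff σ).2 h
    rw [Nat.card_congr (alternatingColoringEquiv σ hg), card_invariantColoring]
  · rw [← exists_alternatingColoring_iff] at h
    push Not at h
    have : IsEmpty {f : α → Bool // ∀ x, f (σ x) = !f x} :=
      ⟨fun f => (h f.1).elim fun x hx => hx (f.2 x)⟩
    exact Nat.card_of_isEmpty

theorem mul_numOrbits [Finite α] (σ : Perm α) (j : ℕ) :
    j * σ.numOrbits j = Nat.card {x // σ.orbitSize x = j} := by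
  let π : {x // σ.orbitSize x = j} → {ω : Quotient (SameCycle.setoid σ) //
      Quotient.liftOn ω σ.orbitSize (fun _ _ h => σ.orbitSize_congr h) = j} :=
    fun x => ⟨⟦x.1⟧, x.2⟩
  have := Fintype.ofFinite {ω : Quotient (SameCycle.setoid σ) //
      Quotient.liftOn ω σ.orbitSize (fun _ _ h => σ.orbitSize_congr h) = j}
  have hfib : ∀ ω, Nat.card {x // π x = ω} = j := by
    rintro ⟨ω, hω⟩
    induction ω using Quotient.inductionOn with
    | h y =>
      refine (Nat.card_congr ?_).trans hω
      exact
      { toFun x := ⟨x.1.1, (Quotient.exact (congrArg Subtype.val x.2)).symm⟩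
        invFun z := ⟨⟨z.1, (orbitSize_congr σ z.2).symm.trans hω⟩,
          Subtype.ext (Quotient.sound z.2.symm)⟩
        left_inv _ := rfl
        right_inv _ := rfl }
  rw [← Nat.card_congr (Equiv.sigmaFiberEquiv π), Nat.card_sigma,
    Finset.sum_congr rfl fun ω _ => hfib ω]
  simp [numOrbits, mul_comm, Nat.card_eq_fintype_card]

end Equiv.Perm

namespace Equiv.Perm
variable {α : Type*} [Fintype α]

theorem card_comp_eq [DecidableEq α] (f : α → Bool) :
    Nat.card {σ : Perm α // f ∘ σ = f} =
      (#{x | f x}).factorial * (Fintype.card α - #{x | f x}).factorial := by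
  classical
  rw [Nat.card_eq_fintype_card, DomMulAct.stabilizer_card, Fintype.prod_bool, Fintype.card_subtype,
    Fintype.card_subtype, ← Finset.card_compl]
  congr 3
  ext; simp

theorem exists_alternating_iff (f : α → Bool) :
    (∃ σ : Perm α, ∀ x, f (σ x) = !f x) ↔ Fintype.card α = 2 * #{x | f x} := by
  have hsplit := Finset.card_filter_add_card_filter_not (s := univ) (fun x => f x = true)
  rw [Finset.card_univ] at hsplit
  constructor
  · rintro ⟨σ, hσ⟩
    have : #{x | f x} = #{x | ¬ f x} :=
      Finset.card_equiv σ fun x => by simp [hσ]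
    lia
  · intro h
    have e : {x // f x = true} ≃ {x // ¬ f x = true} := by
      refine Fintype.equivOfCardEq ?_
      rw [Fintype.card_subtype, Fintype.card_subtype]
      lia
    refine ⟨e.extendSubtype, fun x => ?_⟩
    by_cases hx : f x = true
    · simpa [hx] using e.extendSubtype_mem x hx
    · simpa [hx] using e.extendSubtype_not_mem x hx

variable [DecidableEq α]

theorem card_alternating (f : α → Bool) :
    Nat.card {σ : Perm α // ∀ x, f (σ x) = !f x} =
      if Fintype.card α = 2 * #{x | f x} then
        (#{x | f x}).factorial * (Fintype.card α - #{x | f x}).factorial else 0 := by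
  split_ifs with h
  · obtain ⟨τ, hτ⟩ := (exists_alternating_iff f).2 h
    rw [← card_comp_eq]
    refine Nat.card_congr (Equiv.subtypeEquiv (Equiv.mulLeft τ) fun σ => ?_)
    simp [funext_iff, hτ, ← Bool.not_eq_eq_eq_not]
  · rw [← exists_alternating_iff] at h
    have : IsEmpty {σ : Perm α // ∀ x, f (σ x) = !f x} := ⟨fun σ => h ⟨σ.1, σ.2⟩⟩
    exact Nat.card_of_isEmpty

theorem sum_card_subtype_comm {β γ : Type*} [Fintype β] [Fintype γ] (r : β → γ → Prop) :
    ∑ b, Nat.card {c // r b c} = ∑ c, Nat.card {b // r b c} := by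
  classical
  simp_rw [Nat.card_eq_fintype_card, Fintype.card_subtype]
  exact Finset.sum_card_bipartiteAbove_eq_sum_card_bipartiteBelow r

theorem sum_coloring (g : ℕ → ℕ) :
    ∑ f : α → Bool, g #{x | f x} =
      ∑ m ∈ range (Fintype.card α + 1), (Fintype.card α).choose m * g m := by
  simp_rw [← Finset.card_univ (α := α), ← smul_eq_mul]
  rw [← Finset.sum_powerset_apply_card, Finset.powerset_univ]
  refine Finset.sum_nbij' (fun f => ({x | f x} : Finset α)) (fun s x => decide (x ∈ s))
    ?_ ?_ ?_ ?_ ?_ <;> simp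

theorem sum_two_pow_numCycles :
    ∑ σ : Perm α, 2 ^ σ.numCycles = (Fintype.card α).factorial * (Fintype.card α + 1) := by
  simp_rw [← card_invariantColoring]
  rw [sum_card_subtype_comm fun (σ : Perm α) (f : α → Bool) => f ∘ σ = f]
  simp_rw [card_comp_eq]
  rw [sum_coloring fun m => m.factorial * (Fintype.card α - m).factorial,
    Finset.sum_congr rfl fun m hm => ((mul_assoc _ _ _).symm.trans
      (Nat.choose_mul_factorial_mul_factorial (mem_range_succ_iff.1 hm)))]
  simp [mul_comm]

open scoped Classical in
theorem sum_two_pow_numCycles_allOrbitsEven :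
    ∑ σ : Perm α, (if σ.allOrbitsEven then 2 ^ σ.numCycles else 0) =
      if Even (Fintype.card α) then (Fintype.card α).factorial else 0 := by
  simp_rw [← card_alternatingColoring]
  rw [sum_card_subtype_comm fun (σ : Perm α) (f : α → Bool) => ∀ x, f (σ x) = !f x]
  simp_rw [card_alternating]
  rw [sum_coloring fun m => if Fintype.card α = 2 * m then
    m.factorial * (Fintype.card α - m).factorial else 0]
  simp_rw [mul_ite, mul_zero]
  split_ifs with h
  · obtain ⟨m, hm⟩ := h
    rw [Finset.sum_eq_single m, if_pos (by lia), ← mul_assoc,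
      Nat.choose_mul_factorial_mul_factorial (by lia)]
    · intro k _ hk
      rw [if_neg (by lia)]
    · simp; lia
  · exact Finset.sum_eq_zero fun m _ => if_neg fun hm => h ⟨m, by lia⟩

theorem numOrbits_one (σ : Perm α) : σ.numOrbits 1 = #{x | σ x = x} := by
  rw [← one_mul (σ.numOrbits 1), mul_numOrbits, Nat.card_eq_fintype_card, Fintype.card_subtype]
  simp [orbitSize_eq_minimalPeriod, Function.minimalPeriod_eq_one_iff_isFixedPt, Function.IsFixedPt]

theorem two_mul_numOrbits_two (σ : Perm α) :
    2 * σ.numOrbits 2 = #{p ∈ univ.offDiag | σ p.1 = p.2 ∧ σ p.2 = p.1} := by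
  rw [mul_numOrbits, Nat.card_eq_fintype_card, Fintype.card_subtype]
  have h (x : α) : σ.orbitSize x = 2 ↔ σ (σ x) = x ∧ σ x ≠ x := by
    rw [orbitSize_eq_minimalPeriod, Function.minimalPeriod_eq_prime_iff]; rfl
  refine Finset.card_nbij' (fun x => (x, σ x)) Prod.fst ?_ ?_ ?_ ?_
  · intro x hx
    have hx := (h x).1 (by simpa using hx)
    simp [hx, hx.2.symm]
  · rintro ⟨x, y⟩ hx
    simp only [Finset.coe_filter, Finset.mem_offDiag, Set.mem_ofPred_eq] at hx
    simp [h, hx, Ne.symm hx.1.2.2]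
  · intro x _
    rfl
  · rintro ⟨x, y⟩ hx
    simp_all

theorem two_mul_sum_numOrbits_two :
    2 * ∑ σ : Perm α, σ.numOrbits 2 = ∑ σ : Perm α, (σ.numOrbits 1).descFactorial 2 := by
  have h (σ : Perm α) : (σ.numOrbits 1).descFactorial 2 =
      #{p ∈ univ.offDiag | σ p.1 = p.1 ∧ σ p.2 = p.2} := by
    rw [numOrbits_one, Nat.descFactorial_succ, Nat.descFactorial_one, mul_comm, Nat.mul_sub_one,
      ← Finset.offDiag_card]
    congr 1
    ext; simp; tauto
  simp_rw [Finset.mul_sum, h, two_mul_numOrbits_two, Finset.card_filter]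
  rw [Finset.sum_comm, Finset.sum_comm (s := univ)]
  refine Finset.sum_congr rfl fun p _ =>
    Fintype.sum_equiv (Equiv.mulLeft (swap p.1 p.2)) _ _ fun σ => ?_
  simp [swap_apply_eq_iff]

/-- Embeddings fixed by `σ` are embeddings into the set of fixed points of `σ`. -/
def fixedByEmbeddingEquiv (σ : Perm α) (ι : Type*) :
    MulAction.fixedBy (ι ↪ α) σ ≃ (ι ↪ {x // σ x = x}) where
  toFun f := ⟨fun i => ⟨f.1 i, DFunLike.congr_fun f.2 i⟩, fun _ _ h =>
    f.1.injective (congrArg Subtype.val h)⟩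
  invFun g := ⟨g.trans (.subtype _), Function.Embedding.ext fun i => (g i).2⟩
  left_inv _ := rfl
  right_inv _ := rfl

theorem sum_descFactorial_numOrbits_one {k : ℕ} (hk : k ≤ Fintype.card α) :
    ∑ σ : Perm α, (σ.numOrbits 1).descFactorial k = (Fintype.card α).factorial := by
  have hpre := isMultiplyPretransitive α k
  have : Nonempty (Fin k ↪ α) := Function.Embedding.nonempty_of_card_le (by simpa)
  obtain ⟨_⟩ := (MulAction.pretransitive_iff_unique_quotient_of_nonempty _ _).1 hpre
  have := Fintype.ofFinite (MulAction.orbitRel.Quotient (Perm α) (Fin k ↪ α))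
  have hburnside :=
    MulAction.sum_card_fixedBy_eq_card_orbits_mul_card_group (Perm α) (Fin k ↪ α)
  rw [Fintype.card_unique, one_mul, Fintype.card_perm] at hburnside
  rw [← hburnside]
  refine Finset.sum_congr rfl fun σ _ => ?_
  rw [← Fintype.card_congr (fixedByEmbeddingEquiv σ (Fin k)).symm, Fintype.card_embedding_eq,
    Fintype.card_fin, Fintype.card_subtype, numOrbits_one]

end Equiv.Perm

theorem sum_pi_prod_mem {ι : Type*} [Fintype ι] [DecidableEq ι] {κ : ι → Type*}
    [∀ i, Fintype (κ i)] (f : ∀ i, κ i → ℚ) (u : ι → ℚ)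
    (hf : ∀ i, ∑ x, f i x = Fintype.card (κ i) * u i) (s : Finset ι) :
    ∑ σ : ∀ i, κ i, ∏ i ∈ s, f i (σ i) = (∏ i, (Fintype.card (κ i) : ℚ)) * ∏ i ∈ s, u i := by
  calc ∑ σ : ∀ i, κ i, ∏ i ∈ s, f i (σ i)
      = ∑ σ : ∀ i, κ i, ∏ i, if i ∈ s then f i (σ i) else 1 := by simp
    _ = ∏ i, ∑ x, if i ∈ s then f i x else 1 := by rw [Fintype.prod_sum]
    _ = ∏ i, Fintype.card (κ i) * if i ∈ s then u i else 1 := by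
      refine Finset.prod_congr rfl fun i _ => ?_
      split_ifs <;> simp [hf]
    _ = _ := by rw [Finset.prod_mul_distrib]; simp

theorem sum_pi_choose_two {ι : Type*} [Fintype ι] [DecidableEq ι] {κ : ι → Type*}
    [∀ i, Fintype (κ i)] (n : ∀ i, κ i → ℕ) (v : ι → ℚ)
    (h1 : ∀ i, ∑ x, (n i x : ℚ) = Fintype.card (κ i))
    (h2 : ∀ i, ∑ x, ((n i x).choose 2 : ℚ) = Fintype.card (κ i) * v i) :
    ∑ σ : ∀ i, κ i, ((∑ i, n i (σ i)).choose 2 : ℚ) =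
      (∏ i, (Fintype.card (κ i) : ℚ)) * (∑ i, v i + (Fintype.card ι).choose 2) := by
  have hexp (σ : ∀ i, κ i) : ((∑ i, n i (σ i)).choose 2 : ℚ) =
      ∑ i, ∏ k ∈ {i}, ((n k (σ k)).choose 2 : ℚ) +
        (∑ p ∈ univ.offDiag, ∏ k ∈ {p.1, p.2}, (n k (σ k) : ℚ)) / 2 := by
    have hoff : ∑ p ∈ univ.offDiag, ∏ k ∈ {p.1, p.2}, (n k (σ k) : ℚ) =
        ∑ p ∈ univ.offDiag, (n p.1 (σ p.1) : ℚ) * n p.2 (σ p.2) :=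
      Finset.sum_congr rfl fun p hp => Finset.prod_pair (Finset.mem_offDiag.1 hp).2.2
    have hsq : (∑ i, (n i (σ i) : ℚ)) * ∑ i, (n i (σ i) : ℚ) =
        ∑ i, (n i (σ i) : ℚ) * n i (σ i) +
          ∑ p ∈ univ.offDiag, (n p.1 (σ p.1) : ℚ) * n p.2 (σ p.2) := by
      rw [Finset.sum_mul_sum, ← Finset.sum_product', ← Finset.diag_union_offDiag,
        Finset.sum_union (Finset.disjoint_diag_offDiag _), Finset.sum_diag]
    simp_rw [Finset.prod_singleton, hoff, Nat.cast_choose_two, ← Finset.sum_div, mul_sub,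
      Finset.sum_sub_distrib, mul_one, Nat.cast_sum, hsq]
    ring
  simp_rw [hexp, Finset.sum_add_distrib, ← Finset.sum_div]
  rw [Finset.sum_comm (t := (univ : Finset ι)), Finset.sum_comm (t := univ.offDiag),
    Finset.sum_congr rfl fun i _ =>
      sum_pi_prod_mem (fun i x => ((n i x).choose 2 : ℚ)) v h2 {i},
    Finset.sum_congr (s₁ := univ.offDiag) rfl fun p _ =>
      sum_pi_prod_mem (fun i x => (n i x : ℚ)) (fun _ => 1) (by simpa using h1) {p.1, p.2}]
  simp only [Finset.prod_singleton, Finset.prod_const_one, mul_one, Finset.sum_const,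
    Finset.offDiag_card, Finset.card_univ, nsmul_eq_mul, ← Finset.mul_sum, Nat.cast_choose_two]
  rw [Nat.cast_sub (Nat.le_mul_self _)]
  push_cast
  ring

theorem sum_pi_sum {ι : Type*} [Fintype ι] [DecidableEq ι] {κ : ι → Type*}
    [∀ i, Fintype (κ i)] (f : ∀ i, κ i → ℚ) (u : ι → ℚ)
    (hf : ∀ i, ∑ x, f i x = Fintype.card (κ i) * u i) :
    ∑ σ : ∀ i, κ i, ∑ i, f i (σ i) = (∏ i, (Fintype.card (κ i) : ℚ)) * ∑ i, u i := by
  rw [Finset.sum_comm, Finset.mul_sum]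
  exact Finset.sum_congr rfl fun i _ => by simpa using sum_pi_prod_mem f u hf {i}

namespace Equiv.Perm

theorem sum_numOrbits_one_fin {n : ℕ} (hn : 1 ≤ n) :
    ∑ σ : Perm (Fin n), (σ.numOrbits 1 : ℚ) = n.factorial := by
  have := sum_descFactorial_numOrbits_one (α := Fin n) (k := 1) (by simpa)
  simp only [Nat.descFactorial_one, Fintype.card_fin] at this
  exact_mod_cast this

theorem sum_descFactorial_two_fin {n : ℕ} (hn : 1 ≤ n) :
    ∑ σ : Perm (Fin n), (σ.numOrbits 1).descFactorial 2 =
      n.factorial * if n = 1 then 0 else 1 := by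
  split_ifs with h
  · subst h
    refine Finset.sum_eq_zero fun σ _ => Nat.descFactorial_of_lt ?_
    rw [numOrbits_one]
    exact (Finset.card_le_univ _).trans_lt (by simp)
  · simpa using sum_descFactorial_numOrbits_one (α := Fin n) (k := 2) (by simp; lia)

theorem sum_choose_two_fin {n : ℕ} (hn : 1 ≤ n) :
    ∑ σ : Perm (Fin n), ((σ.numOrbits 1).choose 2 : ℚ) =
      n.factorial * ((if n = 1 then 0 else 1) / 2) := by
  have h : ∑ σ : Perm (Fin n), ((σ.numOrbits 1).descFactorial 2 : ℚ) =
      n.factorial * if n = 1 then 0 else 1 := mod_cast sum_descFactorial_two_fin hn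
  simp_rw [Nat.descFactorial_eq_factorial_mul_choose, Nat.cast_mul, ← Finset.mul_sum] at h
  rw [← mul_div_assoc, ← h]
  simp

theorem sum_numOrbits_two_fin {n : ℕ} (hn : 1 ≤ n) :
    ∑ σ : Perm (Fin n), (σ.numOrbits 2 : ℚ) = n.factorial * ((if n = 1 then 0 else 1) / 2) := by
  have h := two_mul_sum_numOrbits_two (α := Fin n)
  rw [sum_descFactorial_two_fin hn] at h
  rw [← mul_div_assoc, eq_div_iff two_ne_zero, mul_comm]
  exact_mod_cast h

theorem numCycles_pos {α : Type*} [Finite α] [Nonempty α] (σ : Perm α) : 0 < σ.numCycles :=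
  have := Nonempty.map (Quotient.mk (SameCycle.setoid σ)) ‹_›
  Nat.card_pos

end Equiv.Perm

open scoped Classical in
/-- The `n = 0` case of the averaging identity: for `l ≥ 1` and positive integers
`a₁, …, a_l`, the sum over tuples of permutations `σᵢ ∈ S_{aᵢ}` of
`2^{∑c(σᵢ)-1} - 1 - ∑n₂(σᵢ) - C(∑n₁(σᵢ), 2) + δ(σ)` equals
`a₁!⋯a_l! (P - 1 - (l - 𝔞) - C(l,2))`, where `δ(σ) = 2^{∑c(σᵢ)-1}` if every orbit
of every `σᵢ` has even size and `0` otherwise, `𝔞` is the number of indices with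
`aᵢ = 1`, and `P = ((a₁+1)⋯(a_l+1)+1)/2` if all `aᵢ` are even and
`P = (a₁+1)⋯(a_l+1)/2` otherwise. -/
theorem sum_traces_identity_unmarked (l : ℕ) (hl : 1 ≤ l)
    (a : Fin l → ℕ) (ha : ∀ i, 1 ≤ a i) :
    ∑ σ : (i : Fin l) → Equiv.Perm (Fin (a i)),
      ((2 : ℚ) ^ ((∑ i, (σ i).numCycles) - 1) - 1
        - ∑ i, ((σ i).numOrbits 2 : ℚ)
        - Nat.choose (∑ i, (σ i).numOrbits 1) 2
        + (if ∀ i, (σ i).allOrbitsEven then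
            (2 : ℚ) ^ ((∑ i, (σ i).numCycles) - 1) else 0)) =
      (∏ i, (Nat.factorial (a i) : ℚ)) *
        ((if ∀ i, Even (a i) then ((∏ i, ((a i : ℚ) + 1)) + 1) / 2
            else (∏ i, ((a i : ℚ) + 1)) / 2)
          - 1 - ((l : ℚ) - ((Finset.univ.filter fun i => a i = 1).card : ℚ))
          - Nat.choose l 2) := by
  have hcard (i : Fin l) : (Fintype.card (Equiv.Perm (Fin (a i))) : ℚ) = (a i).factorial := by
    simp [Fintype.card_perm]
  have hpow (σ : (i : Fin l) → Equiv.Perm (Fin (a i))) :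
      (2 : ℚ) ^ ((∑ i, (σ i).numCycles) - 1) = (∏ i, (2 : ℚ) ^ (σ i).numCycles) / 2 := by
    let i₀ : Fin l := ⟨0, hl⟩
    have : Nonempty (Fin (a i₀)) := ⟨⟨0, ha i₀⟩⟩
    have hpos : ∑ i, (σ i).numCycles ≠ 0 :=
      ((σ i₀).numCycles_pos.trans_le
        (Finset.single_le_sum (f := fun i => (σ i).numCycles) (fun _ _ => Nat.zero_le _)
          (Finset.mem_univ i₀))).ne'
    rw [Finset.prod_pow_eq_pow_sum, eq_div_iff two_ne_zero, pow_sub_one_mul hpos]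
  have hT (i : Fin l) : ∑ σ : Equiv.Perm (Fin (a i)), (2 : ℚ) ^ σ.numCycles =
      Fintype.card (Equiv.Perm (Fin (a i))) * ((a i : ℚ) + 1) := by
    rw [hcard]
    have := Equiv.Perm.sum_two_pow_numCycles (α := Fin (a i))
    rw [Fintype.card_fin] at this
    exact_mod_cast this
  have hE (i : Fin l) : ∑ σ : Equiv.Perm (Fin (a i)),
      (if σ.allOrbitsEven then (2 : ℚ) ^ σ.numCycles else 0) =
      Fintype.card (Equiv.Perm (Fin (a i))) * (if Even (a i) then 1 else 0) := by
    rw [hcard]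
    have := Equiv.Perm.sum_two_pow_numCycles_allOrbitsEven (α := Fin (a i))
    rw [Fintype.card_fin] at this
    rw [mul_ite, mul_one, mul_zero]
    exact_mod_cast this
  have hδ (σ : (i : Fin l) → Equiv.Perm (Fin (a i))) :
      (if ∀ i, (σ i).allOrbitsEven then (∏ i, (2 : ℚ) ^ (σ i).numCycles) / 2 else 0) =
      (∏ i, if (σ i).allOrbitsEven then (2 : ℚ) ^ (σ i).numCycles else 0) / 2 := by
    simp [Finset.prod_ite_zero, ite_div]
  have hhalf : ∑ i, (if a i = 1 then 0 else 1 : ℚ) / 2 =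
      ((l : ℚ) - ((Finset.univ.filter fun i => a i = 1).card : ℚ)) / 2 := by
    rw [← Finset.sum_div, Finset.natCast_card_filter]
    congr 1
    rw [eq_sub_iff_add_eq, ← Finset.sum_add_distrib]
    simp [ite_add_ite]
  simp_rw [hpow, hδ, Finset.sum_add_distrib, Finset.sum_sub_distrib, ← Finset.sum_div]
  rw [sum_pi_prod_mem _ _ hT, sum_pi_prod_mem _ _ hE,
    sum_pi_sum (fun i (σ : Equiv.Perm (Fin (a i))) => (σ.numOrbits 2 : ℚ)) _
      fun i => by rw [hcard]; exact Equiv.Perm.sum_numOrbits_two_fin (ha i),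
    sum_pi_choose_two (fun i (σ : Equiv.Perm (Fin (a i))) => σ.numOrbits 1) _
      (fun i => by rw [hcard]; exact Equiv.Perm.sum_numOrbits_one_fin (ha i))
      fun i => by rw [hcard]; exact Equiv.Perm.sum_choose_two_fin (ha i)]
  simp only [hcard, hhalf, Fintype.card_fin, Finset.sum_const, Finset.card_univ, Fintype.card_pi,
    nsmul_eq_mul, mul_one, Nat.cast_prod, Finset.prod_ite_zero, Finset.prod_const_one,
    Finset.mem_univ, true_implies]
  split_ifs <;> ring
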